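/- arXiv:0811.2835 — 2 statements merged into one kernel-verified Lean document; each statement's English description precedes it below -/
import Mathlib

section
/- Let P and Q be equivalent commuting projections in a finite von Neumann algebra M (or more generally, P and Q finite equivalent commuting projections), and let 0 ≤ a < b and a ≤ c ≤ b. Then there exist projections P', Q' in M, each equivalent to P, such that a·P + b·Q = c·P' + (a+b-c)·Q'. -/
variable {H : Type*} [NormedAddCommGroup H] [InnerProductSpace ℂ H] [CompleteSpace H]

/-- A (self-adjoint idempotent) projection in `B(H)`. -/
def IsProjectionOp (P : H →L[ℂ] H) : Prop := IsSelfAdjoint P ∧ P * P = P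

/-- Murray–von Neumann equivalence of projections realized inside a von Neumann algebra. -/
def MvNEquivIn (M : VonNeumannAlgebra H) (P Q : H →L[ℂ] H) : Prop :=
  ∃ V ∈ M, star V * V = P ∧ V * star V = Q

/-- `Q` is a subprojection of `P`. -/
def IsSubproj (Q P : H →L[ℂ] H) : Prop := P * Q = Q ∧ Q * P = Q

/-- A projection `P` of a von Neumann algebra `M` is finite if it is not equivalent to a
proper subprojection of itself. -/
def IsFiniteProjIn (M : VonNeumannAlgebra H) (P : H →L[ℂ] H) : Prop :=
  ∀ Q, Q ∈ M → IsProjectionOp Q → IsSubproj Q P → MvNEquivIn M P Q → Q = P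

/-- A subspace of `H × H` which is the graph of an isometry from a subspace of `range p` to a
subspace of `range q` commuting with the commutant of `M`. -/
structure IsIsometricGraph (M : VonNeumannAlgebra H) (p q : H →L[ℂ] H)
    (G : Submodule ℂ (H × H)) : Prop where
  norm_eq : ∀ g ∈ G, ‖g.1‖ = ‖g.2‖
  fst_mem : ∀ g ∈ G, p g.1 = g.1
  snd_mem : ∀ g ∈ G, q g.2 = g.2
  invariant : ∀ S ∈ M.commutant, ∀ g ∈ G, (S g.1, S g.2) ∈ G

lemma mem_of_forall_commutant (M : VonNeumannAlgebra H) {T : H →L[ℂ] H}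
    (h : ∀ S ∈ M.commutant, S * T = T * S) : T ∈ M := by
  rw [← M.commutant_commutant]
  exact VonNeumannAlgebra.mem_commutant_iff.2 h

lemma commute_of_mem_commutant {M : VonNeumannAlgebra H} {S T : H →L[ℂ] H}
    (hS : S ∈ M.commutant) (hT : T ∈ M) : T * S = S * T :=
  VonNeumannAlgebra.mem_commutant_iff.1 hS T hT

lemma starProjection_mem_of_invariant (M : VonNeumannAlgebra H) (K : Submodule ℂ H)
    [K.HasOrthogonalProjection] (h : ∀ S ∈ M.commutant, ∀ x ∈ K, S x ∈ K) :
    K.starProjection ∈ M := by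
  rw [VonNeumannAlgebra.IsStarProjection.mem_iff isStarProjection_starProjection]
  intro S hS
  rw [Submodule.range_starProjection]
  exact fun x hx => h S hS x hx

lemma mul_eq_self_of_star_mul_self_eq {V P : H →L[ℂ] H} (hP : IsProjectionOp P)
    (h : star V * V = P) : V * P = V := by
  refine sub_eq_zero.1 ((CStarRing.star_mul_self_eq_zero_iff _).1 ?_)
  rw [star_sub, star_mul, hP.1.star_eq, sub_mul, mul_sub, mul_sub, mul_assoc P, mul_assoc P,
    ← mul_assoc (star V), h, hP.2, hP.2, sub_self]

lemma IsProjectionOp.mul {P Q : H →L[ℂ] H} (hP : IsProjectionOp P) (hQ : IsProjectionOp Q)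
    (hcomm : P * Q = Q * P) : IsProjectionOp (P * Q) := by
  refine ⟨?_, ?_⟩
  · rw [IsSelfAdjoint, star_mul, hP.1.star_eq, hQ.1.star_eq, hcomm]
  · rw [mul_assoc, ← mul_assoc Q, ← hcomm, mul_assoc P Q Q, hQ.2, ← mul_assoc, hP.2]

lemma IsProjectionOp.sub {P R : H →L[ℂ] H} (hP : IsProjectionOp P) (hR : IsProjectionOp R)
    (hPR : P * R = R) (hRP : R * P = R) : IsProjectionOp (P - R) :=
  ⟨hP.1.sub hR.1, by rw [sub_mul, mul_sub, mul_sub, hP.2, hPR, hRP, hR.2, sub_self, sub_zero]⟩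

lemma star_mul_self_eq_starProjection (K : Submodule ℂ H) [K.HasOrthogonalProjection]
    (W : H →L[ℂ] H) (h : ∀ x, ‖W x‖ = ‖K.starProjection x‖) :
    star W * W = K.starProjection := by
  have hK : star K.starProjection * K.starProjection = K.starProjection := by
    rw [isStarProjection_starProjection.isSelfAdjoint.star_eq]
    exact isStarProjection_starProjection.isIdempotentElem
  rw [← hK]
  apply ContinuousLinearMap.coe_injective
  rw [← ext_inner_map]
  intro x
  simp only [ContinuousLinearMap.star_eq_adjoint, ContinuousLinearMap.coe_coe,
    mul_apply_eq_comp, ContinuousLinearMap.adjoint_inner_left,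
    inner_self_eq_norm_sq_to_K, h]

lemma IsIsometricGraph.exists_partialIsometry {M : VonNeumannAlgebra H} {p q : H →L[ℂ] H}
    {G : Submodule ℂ (H × H)} (hG : IsIsometricGraph M p q G) (hp : IsSelfAdjoint p)
    (hc : IsClosed (G : Set (H × H))) :
    ∃ W ∈ M, q * W = W ∧ W * p = W ∧ W * star W * W = W ∧
      ∀ g ∈ G, star W (W g.1) = g.1 ∧ W g.1 = g.2 := by
  let e : G →ₗᵢ[ℂ] H := ⟨LinearMap.fst ℂ H H ∘ₗ G.subtype, fun g => by
    have := hG.norm_eq g g.2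
    simp [Prod.norm_def, this]⟩
  have he (g : G) : e g = g.1.1 := rfl
  have : CompleteSpace G := hc.completeSpace_coe
  let K : Submodule ℂ H := LinearMap.range e.toLinearMap
  have hK : IsClosed (K : Set H) := by
    have := e.isometry.isClosedEmbedding.isClosed_range
    simpa [K] using! this
  have : CompleteSpace K := hK.completeSpace_coe
  have hKmem (x : H) : ∃ g ∈ G, g.1 = K.starProjection x := by
    obtain ⟨g, hg⟩ := K.starProjection_apply_mem x
    exact ⟨g, g.2, hg⟩
  let W : H →L[ℂ] H := ContinuousLinearMap.snd ℂ H H ∘L G.subtypeL ∘L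
    (e.equivRange.symm : K →L[ℂ] G) ∘L K.orthogonalProjectionOnto
  have hW (x : H) : (K.starProjection x, W x) ∈ G := by
    have h1 : e (e.equivRange.symm (K.orthogonalProjectionOnto x)) = K.starProjection x :=
      congrArg Subtype.val (e.equivRange.apply_symm_apply (K.orthogonalProjectionOnto x))
    rw [← h1]
    exact (e.equivRange.symm (K.orthogonalProjectionOnto x)).2
  have huniq (x y z : H) (hy : (x, y) ∈ G) (hz : (x, z) ∈ G) : y = z := by
    have := hG.norm_eq _ (G.sub_mem hy hz)
    simp only [Prod.fst_sub, Prod.snd_sub, sub_self, norm_zero] at this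
    exact sub_eq_zero.1 (norm_eq_zero.1 this.symm)
  have hEM : K.starProjection ∈ M := by
    refine starProjection_mem_of_invariant M K fun S hS x hx => ?_
    obtain ⟨g, rfl⟩ := hx
    exact ⟨⟨_, hG.invariant S hS g g.2⟩, rfl⟩
  have hWW : star W * W = K.starProjection :=
    star_mul_self_eq_starProjection K W fun x => (hG.norm_eq _ (hW x)).symm
  have hWfst (g : H × H) (hg : g ∈ G) : K.starProjection g.1 = g.1 :=
    Submodule.starProjection_eq_self_iff.2 ⟨⟨g, hg⟩, rfl⟩
  have hWE : W * K.starProjection = W := by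
    ext x
    refine huniq (K.starProjection x) _ _ ?_ (hW x)
    have := hW (K.starProjection x)
    rwa [Submodule.starProjection_eq_self_iff.2 (K.starProjection_apply_mem x)] at this
  have hpE : p * K.starProjection = K.starProjection := by
    ext x
    exact hG.fst_mem _ (hW x)
  have hEp : K.starProjection * p = K.starProjection := by
    have := congrArg star hpE
    rwa [star_mul, hp.star_eq, isStarProjection_starProjection.isSelfAdjoint.star_eq] at this
  refine ⟨W, mem_of_forall_commutant M fun S hS => ?_, ?_, ?_, ?_, fun g hg => ⟨?_, ?_⟩⟩
  · ext x
    refine huniq (K.starProjection (S x)) _ _ ?_ (hW (S x))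
    have h1 := hG.invariant S hS _ (hW x)
    have h2 := DFunLike.congr_fun (commute_of_mem_commutant hS hEM) x
    simp only [mul_apply_eq_comp] at h1 h2
    rw [h2]
    exact h1
  · ext x
    exact hG.snd_mem (K.starProjection x, W x) (hW x)
  · rw [← hWE, mul_assoc, hEp]
  · rw [mul_assoc, hWW, hWE]
  · rw [← mul_apply_eq_comp, hWW, hWfst g hg]
  · refine huniq g.1 _ _ ?_ hg
    have := hW g.1
    rwa [hWfst g hg] at this

lemma IsIsometricGraph.topologicalClosure {M : VonNeumannAlgebra H} {p q : H →L[ℂ] H}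
    {G : Submodule ℂ (H × H)} (hG : IsIsometricGraph M p q G) :
    IsIsometricGraph M p q G.topologicalClosure := by
  have key (C : Set (H × H)) (hC : IsClosed C) (h : ∀ g ∈ G, g ∈ C) :
      ∀ g ∈ G.topologicalClosure, g ∈ C := closure_minimal h hC
  refine ⟨key {g | ‖g.1‖ = ‖g.2‖} (isClosed_eq (by fun_prop) (by fun_prop)) hG.norm_eq,
    key {g | p g.1 = g.1} (isClosed_eq (by fun_prop) (by fun_prop)) hG.fst_mem,
    key {g | q g.2 = g.2} (isClosed_eq (by fun_prop) (by fun_prop)) hG.snd_mem,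
    fun S hS => ?_⟩
  refine key ((fun g : H × H => (S g.1, S g.2)) ⁻¹' G.topologicalClosure)
    (G.isClosed_topologicalClosure.preimage (by fun_prop)) fun g hg => ?_
  exact G.le_topologicalClosure (hG.invariant S hS g hg)

lemma exists_maximal_isometricGraph (M : VonNeumannAlgebra H) (p q : H →L[ℂ] H) :
    ∃ G, Maximal (IsIsometricGraph M p q) G := by
  have hbot : IsIsometricGraph M p q ⊥ := by
    constructor <;> simp
  obtain ⟨G, -, hG⟩ := zorn_le_nonempty₀ {G | IsIsometricGraph M p q G} (by
    intro c hc hchain y hy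
    refine ⟨sSup c, ?_, fun z hz => le_sSup hz⟩
    have hmem (g : H × H) : g ∈ sSup c ↔ ∃ G ∈ c, g ∈ G :=
      Submodule.mem_sSup_of_directed ⟨y, hy⟩ hchain.directedOn
    constructor <;> simp only [hmem]
    · rintro g ⟨G, hGc, hg⟩
      exact (hc hGc).norm_eq g hg
    · rintro g ⟨G, hGc, hg⟩
      exact (hc hGc).fst_mem g hg
    · rintro g ⟨G, hGc, hg⟩
      exact (hc hGc).snd_mem g hg
    · rintro S hS g ⟨G, hGc, hg⟩
      exact ⟨G, hGc, (hc hGc).invariant S hS g hg⟩) ⊥ hbot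
  exact ⟨G, hG⟩

lemma norm_add_eq_of_inner_eq_zero {E : Type*} [NormedAddCommGroup E] [InnerProductSpace ℂ E]
    {x y x' y' : E} (h : inner ℂ x y = 0) (h' : inner ℂ x' y' = 0)
    (hx : ‖x‖ = ‖x'‖) (hy : ‖y‖ = ‖y'‖) : ‖x + y‖ = ‖x' + y'‖ := by
  have h1 := norm_add_sq_eq_norm_sq_add_norm_sq_of_inner_eq_zero x y h
  have h2 := norm_add_sq_eq_norm_sq_add_norm_sq_of_inner_eq_zero x' y' h'
  rw [hx, hy] at h1
  nlinarith [norm_nonneg (x + y), norm_nonneg (x' + y')]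

lemma norm_abs_apply (T : H →L[ℂ] H) (x : H) : ‖CFC.abs T x‖ = ‖T x‖ := by
  have h : ((CFC.abs T * CFC.abs T : H →L[ℂ] H)) = star T * T := CFC.abs_mul_abs T
  have hs : star (CFC.abs T) = CFC.abs T := (CFC.abs_nonneg T).isSelfAdjoint.star_eq
  have h1 : inner ℂ (star (CFC.abs T) (CFC.abs T x)) x = inner ℂ (star T (T x)) x := by
    rw [hs]
    exact congrArg (fun A : H →L[ℂ] H => inner ℂ (A x) x) h
  simp only [ContinuousLinearMap.star_eq_adjoint, ContinuousLinearMap.adjoint_inner_left,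
    inner_self_eq_norm_sq_to_K] at h1
  have h2 : ‖CFC.abs T x‖ ^ 2 = ‖T x‖ ^ 2 := by exact_mod_cast h1
  exact (sq_eq_sq₀ (norm_nonneg _) (norm_nonneg _)).1 h2

lemma exists_maximal_partialIsometry (M : VonNeumannAlgebra H) {p q : H →L[ℂ] H}
    (hpM : p ∈ M) (hqM : q ∈ M) (hp : IsProjectionOp p) (hq : IsProjectionOp q) :
    ∃ W ∈ M, q * W = W ∧ W * p = W ∧ W * star W * W = W ∧
      ∀ T ∈ M, (q - W * star W) * T * (p - star W * W) = 0 := by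
  obtain ⟨G, hG⟩ := exists_maximal_isometricGraph M p q
  have hc : IsClosed (G : Set (H × H)) := by
    have := hG.eq_of_le hG.prop.topologicalClosure G.le_topologicalClosure
    rw [this]
    exact G.isClosed_topologicalClosure
  obtain ⟨W, hWM, hqW, hWp, hWWW, hWG⟩ := hG.prop.exists_partialIsometry hp.1 hc
  refine ⟨W, hWM, hqW, hWp, hWWW, fun T₀ hT₀ => ?_⟩
  have hsW : p * star W = star W := by
    have := congrArg star hWp
    rwa [star_mul, hp.1.star_eq] at this
  have hsW' : star W * W * star W = star W := by
    have := congrArg star hWWW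
    rwa [star_mul, star_mul, star_star, ← mul_assoc] at this
  have hsWM : star W ∈ M := star_mem hWM
  set p₁ := p - star W * W with hp₁
  set q₁ := q - W * star W with hq₁
  have hp₁M : p₁ ∈ M := sub_mem hpM (mul_mem hsWM hWM)
  have hq₁M : q₁ ∈ M := sub_mem hqM (mul_mem hWM hsWM)
  have hWp₁ : W * p₁ = 0 := by rw [hp₁, mul_sub, hWp, ← mul_assoc, hWWW, sub_self]
  have hWq₁ : star W * q₁ = 0 := by
    have : star W * q = star W := by
      have := congrArg star hqW
      rwa [star_mul, hq.1.star_eq] at this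
    rw [hq₁, mul_sub, this, ← mul_assoc, hsW', sub_self]
  have hpp₁ : p * p₁ = p₁ := by rw [hp₁, mul_sub, hp.2, ← mul_assoc, hsW]
  have hqq₁ : q * q₁ = q₁ := by rw [hq₁, mul_sub, hq.2, ← mul_assoc, hqW]
  have hp₁sa : star p₁ = p₁ := by simp [hp₁, hp.1.star_eq]
  have hp₁p₁ : p₁ * p₁ = p₁ := by
    nth_rewrite 1 [hp₁]
    rw [sub_mul, hpp₁, mul_assoc, hWp₁, mul_zero, sub_zero]
  set T := q₁ * T₀ * p₁ with hT
  have hTM : T ∈ M := mul_mem (mul_mem hq₁M hT₀) hp₁M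
  have hTp : T * p₁ = T := by rw [hT, mul_assoc, hp₁p₁]
  have hqT : q * T = T := by rw [hT, ← mul_assoc, ← mul_assoc, hqq₁]
  have hWT : star W * T = 0 := by
    rw [hT, ← mul_assoc, ← mul_assoc, hWq₁, zero_mul, zero_mul]
  set A : H →L[ℂ] H := CFC.abs T with hA
  have hAsa : star A = A := (CFC.abs_nonneg T).isSelfAdjoint.star_eq
  have hAp : A * p₁ = A := by
    ext x
    rw [← sub_eq_zero, mul_apply_eq_comp, ← map_sub, ← norm_eq_zero,
      norm_abs_apply, map_sub, ← mul_apply_eq_comp, hTp, sub_self, norm_zero]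
  have hpA : p₁ * A = A := by
    have := congrArg star hAp
    rwa [star_mul, hAsa, hp₁sa] at this
  have hWA : W * A = 0 := by rw [← hpA, ← mul_assoc, hWp₁, zero_mul]
  have hpA' : p * A = A := by rw [← hpA, ← mul_assoc, hpp₁]
  have hcomm (S : H →L[ℂ] H) (hS : S ∈ M.commutant) : S * A = A * S := by
    have h1 : Commute T S := commute_of_mem_commutant hS hTM
    have h2 : Commute T (star S) := commute_of_mem_commutant (star_mem hS) hTM
    exact (h1.cfcAbs_left h2).symm
  let L : H →ₗ[ℂ] H × H := A.toLinearMap.prod T.toLinearMap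
  have hG' : IsIsometricGraph M p q (G ⊔ LinearMap.range L) := by
    constructor <;> simp only [Submodule.mem_sup, LinearMap.mem_range]
    · rintro _ ⟨g, hg, _, ⟨x, rfl⟩, rfl⟩
      obtain ⟨h1, h2⟩ := hWG g hg
      refine norm_add_eq_of_inner_eq_zero ?_ ?_ (hG.prop.norm_eq g hg) (norm_abs_apply T x)
      · rw [← h1, ContinuousLinearMap.star_eq_adjoint, ContinuousLinearMap.adjoint_inner_left]
        have : W (A x) = 0 := DFunLike.congr_fun hWA x
        exact (congrArg _ this).trans (inner_zero_right _)
      · rw [← h2, ← ContinuousLinearMap.adjoint_inner_right]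
        have : star W (T x) = 0 := DFunLike.congr_fun hWT x
        exact (congrArg _ this).trans (inner_zero_right _)
    · rintro _ ⟨g, hg, _, ⟨x, rfl⟩, rfl⟩
      have h1 : p (A x) = A x := DFunLike.congr_fun hpA' x
      change p (g.1 + A x) = g.1 + A x
      rw [map_add, hG.prop.fst_mem g hg, h1]
    · rintro _ ⟨g, hg, _, ⟨x, rfl⟩, rfl⟩
      have h1 : q (T x) = T x := DFunLike.congr_fun hqT x
      change q (g.2 + T x) = g.2 + T x
      rw [map_add, hG.prop.snd_mem g hg, h1]
    · rintro S hS _ ⟨g, hg, _, ⟨x, rfl⟩, rfl⟩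
      refine ⟨_, hG.prop.invariant S hS g hg, _, ⟨S x, rfl⟩, ?_⟩
      have h1 : S (A x) = A (S x) := DFunLike.congr_fun (hcomm S hS) x
      have h2 : T (S x) = S (T x) := DFunLike.congr_fun (commute_of_mem_commutant hS hTM) x
      change (S g.1 + A (S x), S g.2 + T (S x)) = (S (g.1 + A x), S (g.2 + T x))
      rw [map_add, map_add, h1, h2]
  have hle : LinearMap.range L ≤ G :=
    le_sup_right.trans (hG.le_of_ge hG' le_sup_left)
  ext x
  obtain ⟨h1, h2⟩ := hWG _ (hle ⟨x, rfl⟩)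
  have h3 : W (A x) = 0 := DFunLike.congr_fun hWA x
  have h4 : W (A x) = T x := h2
  rw [← h4, h3, zero_apply]

lemma exists_central_projection (M : VonNeumannAlgebra H) {p q : H →L[ℂ] H}
    (hpM : p ∈ M) (h : ∀ T ∈ M, q * T * p = 0) :
    ∃ z ∈ M, z ∈ M.commutant ∧ IsStarProjection z ∧ z * p = p ∧ q * z = 0 := by
  let K₀ : Submodule ℂ H := Submodule.span ℂ {y | ∃ T ∈ M, ∃ x, y = T (p x)}
  let K : Submodule ℂ H := K₀.topologicalClosure
  have hK₀ : K₀ ≤ K := K₀.le_topologicalClosure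
  have hKc : IsClosed (K : Set H) := K₀.isClosed_topologicalClosure
  have : CompleteSpace K := hKc.completeSpace_coe
  have key (S : H →L[ℂ] H) (L : Submodule ℂ H) (hL : IsClosed (L : Set H))
      (hS : ∀ T ∈ M, ∀ x, S (T (p x)) ∈ L) : ∀ x ∈ K, S x ∈ L := by
    have h1 : K₀ ≤ L.comap S.toLinearMap := by
      refine Submodule.span_le.2 ?_
      rintro _ ⟨T, hT, x, rfl⟩
      exact hS T hT x
    exact fun x hx => K₀.topologicalClosure_minimal h1 (hL.preimage S.continuous) hx
  refine ⟨K.starProjection, ?_, ?_, isStarProjection_starProjection, ?_, ?_⟩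
  · refine starProjection_mem_of_invariant M K fun S hS => key S K hKc fun T hT x => ?_
    have h1 : T (p (S x)) = S (T (p x)) :=
      DFunLike.congr_fun (commute_of_mem_commutant hS (mul_mem hT hpM)) x
    rw [← h1]
    exact hK₀ (Submodule.subset_span ⟨T, hT, S x, rfl⟩)
  · refine starProjection_mem_of_invariant _ K fun S hS => key S K hKc fun T hT x => ?_
    rw [M.commutant_commutant] at hS
    exact hK₀ (Submodule.subset_span ⟨S * T, mul_mem hS hT, x, rfl⟩)
  · ext x
    exact Submodule.starProjection_eq_self_iff.2
      (hK₀ (Submodule.subset_span ⟨1, one_mem M, x, rfl⟩))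
  · ext x
    have := key q ⊥ (by simp) (fun T hT x => by
      have : q (T (p x)) = 0 := DFunLike.congr_fun (h T hT) x
      simp [this]) _ (K.starProjection_apply_mem x)
    simpa using this

lemma star_mul_self_central_combination {R : Type*} [Ring R] [StarRing R] {z A B : R}
    (hz : IsStarProjection z) (hA : z * A = A * z) (hB : z * B = B * z) :
    star (z * A + (1 - z) * B) * (z * A + (1 - z) * B) =
      z * (star A * A) + (1 - z) * (star B * B) := by
  have hzz : z * z = z := hz.isIdempotentElem
  have hzs : star z = z := hz.isSelfAdjoint.star_eq
  have hA' : star A * z = z * star A := by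
    simpa [hzs] using congrArg star hA
  have hB' : star B * z = z * star B := by
    simpa [hzs] using congrArg star hB
  have e1 : star A * z * (z * A) = z * (star A * A) := by
    rw [hA', mul_assoc, ← mul_assoc (star A), hA', ← mul_assoc, ← mul_assoc, hzz, mul_assoc]
  have e2 : star A * z * ((1 - z) * B) = 0 := by
    rw [mul_assoc, ← mul_assoc z, mul_sub, hzz, mul_one, sub_self, zero_mul, mul_zero]
  have e3 : star B * (1 - z) * (z * A) = 0 := by
    rw [mul_assoc, ← mul_assoc (1 - z), sub_mul, hzz, one_mul, sub_self, zero_mul, mul_zero]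
  have e4 : star B * (1 - z) * ((1 - z) * B) = (1 - z) * (star B * B) := by
    have h1 : star B * (1 - z) = (1 - z) * star B := by
      rw [mul_sub, sub_mul, hB', mul_one, one_mul]
    have h2 : (1 - z) * (1 - z) = 1 - z := hz.isIdempotentElem.one_sub
    rw [h1, mul_assoc, ← mul_assoc (star B), h1, ← mul_assoc, ← mul_assoc, h2, mul_assoc]
  have hs : star (z * A + (1 - z) * B) = star A * z + star B * (1 - z) := by
    simp [hzs]
  rw [hs, add_mul, mul_add, mul_add, e1, e2, e3, e4, zero_add, add_zero]

lemma star_mul_self_eq_sub_of_maximal (M : VonNeumannAlgebra H) {P Q R V W : H →L[ℂ] H}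
    (hPM : P ∈ M) (hRM : R ∈ M) (hVM : V ∈ M) (hWM : W ∈ M)
    (hP : IsProjectionOp P) (hR : IsProjectionOp R) (hPR : P * R = R)
    (hQR : Q * R = R) (hPfin : IsFiniteProjIn M P)
    (hVP : star V * V = P) (hVQ : V * star V = Q)
    (hW : W * (P - R) = W) (hW' : (Q - R) * W = W) (hWWW : W * star W * W = W)
    (hmax : ∀ T ∈ M, (Q - R - W * star W) * T * (P - R - star W * W) = 0) :
    star W * W = P - R := by
  have hQM : Q ∈ M := hVQ ▸ mul_mem hVM (star_mem hVM)
  have hsWM : star W ∈ M := star_mem hWM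
  have hQsa : star Q = Q := by rw [← hVQ]; simp
  have hPsa : star P = P := hP.1
  have hRsa : star R = R := hR.1
  have hRP : R * P = R := by simpa [hPsa, hRsa] using congrArg star hPR
  have hRQ : R * Q = R := by simpa [hQsa, hRsa] using congrArg star hQR
  have hWR : W * R = 0 := by
    rw [← hW, mul_assoc, sub_mul, hPR, hR.2, sub_self, mul_zero]
  have hRW : R * W = 0 := by
    rw [← hW', ← mul_assoc, mul_sub, hRQ, hR.2, sub_self, zero_mul]
  have hWP : W * P = W := by simpa [mul_sub, hWR] using hW
  have hQW : Q * W = W := by simpa [sub_mul, hRW] using hW'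
  have hRsW : R * star W = 0 := by simpa [hRsa] using congrArg star hWR
  have hsWR : star W * R = 0 := by simpa [hRsa] using congrArg star hRW
  have hPsW : P * star W = star W := by simpa [hPsa] using congrArg star hWP
  obtain ⟨z, hzM, hzM', hz, hzp, hqz⟩ := exists_central_projection M
    (sub_mem (sub_mem hPM hRM) (mul_mem hsWM hWM)) hmax
  have hzc (T : H →L[ℂ] H) (hT : T ∈ M) : z * T = T * z :=
    (commute_of_mem_commutant hzM' hT).symm
  set E := star W * W + R with hE
  have hEM : E ∈ M := add_mem (mul_mem hsWM hWM) hRM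
  set Y := (star W + R) * V with hY
  have hYM : Y ∈ M := mul_mem (add_mem hsWM hRM) hVM
  have hsY : star Y = star V * (W + R) := by rw [hY, star_mul, star_add, star_star, hRsa]
  have hQV : star V * Q * V = P := by
    rw [← hVQ, ← mul_assoc, hVP, mul_assoc, hVP, hP.2]
  have hY1 : z * (star Y * Y) = z * P := by
    have h1 : star Y * Y = star V * (W * star W + R) * V := by
      rw [hsY, hY, ← mul_assoc, mul_assoc (star V), add_mul W R, mul_add W, mul_add R, hWR, hRsW,
        hR.2, add_zero, zero_add]
    have h2 : (W * star W + R) * z = Q * z := by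
      have : (W * star W + R) = Q - (Q - R - W * star W) := by abel
      rw [this, sub_mul, hqz, sub_zero]
    have h3 : W * star W + R ∈ M := add_mem (mul_mem hWM hsWM) hRM
    rw [h1, hzc _ (mul_mem (mul_mem (star_mem hVM) h3) hVM), mul_assoc, ← hzc V hVM,
      ← mul_assoc, mul_assoc (star V), h2, ← mul_assoc, mul_assoc (star V * Q), hzc V hVM,
      ← mul_assoc, hQV, hzc P hPM]
  have hY2 : Y * star Y = E := by
    rw [hsY, hY, mul_assoc, ← mul_assoc V, hVQ, mul_add Q, hQW, hQR, add_mul, mul_add, mul_add,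
      hsWR, hRW, hR.2, add_zero, zero_add]
  have hzE : z * E = z * P - (P - R - star W * W) := by
    have : E = P - (P - R - star W * W) := by rw [hE]; abel
    rw [this, mul_sub, hzp]
  have hEP : E = P := by
    refine hPfin E hEM ⟨?_, ?_⟩ ⟨?_, ?_⟩ ⟨z * Y + (1 - z) * P,
      add_mem (mul_mem hzM hYM) (mul_mem (sub_mem (one_mem M) hzM) hPM), ?_, ?_⟩
    · simp [hE, IsSelfAdjoint, hRsa]
    · rw [hE, add_mul, mul_add, mul_add, hR.2, mul_assoc (star W) W R, hWR, ← mul_assoc R, hRsW,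
        mul_assoc, ← mul_assoc W, hWWW]
      simp
    · rw [hE, mul_add, ← mul_assoc, hPsW, hPR]
    · rw [hE, add_mul, mul_assoc, hWP, hRP]
    · rw [star_mul_self_central_combination hz (hzc Y hYM) (hzc P hPM), hY1, hPsa, hP.2, sub_mul,
        one_mul]
      abel
    · have h1 : star (z * Y + (1 - z) * P) = z * star Y + (1 - z) * star P := by
        have := (commute_of_mem_commutant hzM' (star_mem hYM))
        simp [hz.isSelfAdjoint.star_eq, this, sub_mul, hPsa, hzc P hPM]
      have h2 := star_mul_self_central_combination hz (hzc _ (star_mem hYM))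
        (hzc _ (star_mem hPM))
      rw [← h1, star_star, star_star, star_star, hY2, hzE, hPsa, hP.2] at h2
      rw [h2, hE, sub_mul, one_mul]
      abel
  rw [← hEP, hE, add_sub_cancel_right]

/-- The complements of the product of two commuting equivalent finite projections are
equivalent. -/
lemma mvNEquivIn_sub_mul (M : VonNeumannAlgebra H) {P Q : H →L[ℂ] H}
    (hPM : P ∈ M) (hQM : Q ∈ M) (hP : IsProjectionOp P) (hQ : IsProjectionOp Q)
    (hPfin : IsFiniteProjIn M P) (hQfin : IsFiniteProjIn M Q)
    (hcomm : P * Q = Q * P) (hequiv : MvNEquivIn M P Q) :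
    MvNEquivIn M (P - P * Q) (Q - P * Q) := by
  obtain ⟨V, hVM, hVP, hVQ⟩ := hequiv
  set R := P * Q with hRdef
  have hRM : R ∈ M := mul_mem hPM hQM
  have hPR : P * R = R := by rw [hRdef, ← mul_assoc, hP.2]
  have hQR : Q * R = R := by rw [hcomm, ← mul_assoc, hQ.2]
  have hRP : R * P = R := by rw [hcomm, mul_assoc, hP.2]
  have hRQ : R * Q = R := by rw [hRdef, mul_assoc, hQ.2]
  have hR : IsProjectionOp R := hP.mul hQ hcomm
  have hpR : IsProjectionOp (P - R) := hP.sub hR hPR hRP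
  have hqR : IsProjectionOp (Q - R) := hQ.sub hR hQR hRQ
  obtain ⟨W, hWM, hqW, hWp, hWWW, hmax⟩ := exists_maximal_partialIsometry M
    (sub_mem hPM hRM) (sub_mem hQM hRM) hpR hqR
  refine ⟨W, hWM, star_mul_self_eq_sub_of_maximal M hPM hRM hVM hWM hP hR hPR hQR hPfin hVP hVQ
    hWp hqW hWWW hmax, ?_⟩
  have := star_mul_self_eq_sub_of_maximal M (W := star W) (V := star V) hQM hRM (star_mem hVM)
    (star_mem hWM) hQ hR hQR hPR hQfin (by simpa using hVQ) (by simpa using hVP)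
    (by simpa [hqR.1.star_eq] using congrArg star hqW)
    (by simpa [hpR.1.star_eq] using congrArg star hWp)
    (by simpa [mul_assoc] using congrArg star hWWW)
    (fun T hT => by
      simpa [hP.1.star_eq, hQ.1.star_eq, hR.1.star_eq, mul_assoc] using
        congrArg star (hmax (star T) (star_mem hT)))
  simpa using this

lemma smul_mem_vonNeumannAlgebra (M : VonNeumannAlgebra H) (r : ℂ) {T : H →L[ℂ] H}
    (hT : T ∈ M) : r • T ∈ M :=
  M.toStarSubalgebra.smul_mem hT r

/-- The rotation of `R + p` by the angle with cosine `α` and sine `β` in the plane spanned by the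
equivalent orthogonal projections `p` and `q`. -/
lemma exists_rotated_projection (M : VonNeumannAlgebra H) {p q R W : H →L[ℂ] H}
    (hpM : p ∈ M) (hRM : R ∈ M) (hWM : W ∈ M)
    (hp : IsProjectionOp p) (hR : IsProjectionOp R)
    (hpq : p * q = 0) (hRp : R * p = 0) (hRq : R * q = 0)
    (hWp : star W * W = p) (hWq : W * star W = q) (α β : ℝ) (hαβ : α ^ 2 + β ^ 2 = 1) :
    ∃ P' ∈ M, IsProjectionOp P' ∧ MvNEquivIn M (R + p) P' ∧
      P' = R + ((α ^ 2 : ℝ) : ℂ) • p + ((α * β : ℝ) : ℂ) • (W + star W)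
        + ((β ^ 2 : ℝ) : ℂ) • q := by
  have hpsa : star p = p := hp.1
  have hRsa : star R = R := hR.1
  have hqsa : star q = q := by rw [← hWq]; simp
  have hWpW : W * p = W := mul_eq_self_of_star_mul_self_eq hp hWp
  have hqW : q * W = W := by rw [← hWq, mul_assoc, hWp, hWpW]
  have hpsW : p * star W = star W := by simpa [hpsa] using congrArg star hWpW
  have hpR : p * R = 0 := by simpa [hpsa, hRsa] using congrArg star hRp
  have hpW : p * W = 0 := by rw [← hqW, ← mul_assoc, hpq, zero_mul]
  have hsWp : star W * p = 0 := by simpa [hpsa] using congrArg star hpW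
  have hRW : R * W = 0 := by rw [← hqW, ← mul_assoc, hRq, zero_mul]
  have hsWR : star W * R = 0 := by simpa [hRsa] using congrArg star hRW
  have hWR : W * R = 0 := by rw [← hWpW, mul_assoc, hpR, mul_zero]
  have hRsW : R * star W = 0 := by simpa [hRsa] using congrArg star hWR
  set X : H →L[ℂ] H := R + (α : ℂ) • p + (β : ℂ) • W with hX
  have hXM : X ∈ M := add_mem (add_mem hRM (smul_mem_vonNeumannAlgebra M _ hpM))
    (smul_mem_vonNeumannAlgebra M _ hWM)
  have hsX : star X = R + (α : ℂ) • p + (β : ℂ) • star W := by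
    simp [hX, hpsa, hRsa]
  have hαβ' : (α : ℂ) * α + (β : ℂ) * β = 1 := by
    have : α * α + β * β = 1 := by linarith [sq α, sq β]
    exact_mod_cast this
  have h1 : star X * X = R + p := by
    rw [hsX, hX]
    simp only [add_mul, mul_add, smul_mul_assoc, mul_smul_comm, hR.2, hp.2, hRp, hpR, hRW, hpW,
      hsWR, hsWp, hWp, smul_zero, add_zero, zero_add, smul_smul]
    rw [add_assoc, ← add_smul, hαβ', one_smul]
  have h2 : X * star X = R + ((α ^ 2 : ℝ) : ℂ) • p + ((α * β : ℝ) : ℂ) • (W + star W)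
        + ((β ^ 2 : ℝ) : ℂ) • q := by
    rw [hsX, hX]
    simp only [add_mul, mul_add, smul_mul_assoc, mul_smul_comm, hR.2, hp.2, hRp, hpR, hRsW, hWR,
      hpsW, hWpW, hWq, smul_zero, add_zero, zero_add]
    push_cast
    module
  have hXX : X * (R + p) = X := by
    rw [hX]
    simp only [add_mul, mul_add, smul_mul_assoc, hR.2, hp.2, hRp, hpR, hWR, hWpW, smul_zero,
      add_zero, zero_add, add_assoc]
  refine ⟨X * star X, mul_mem hXM (star_mem hXM), ⟨by simp [IsSelfAdjoint], ?_⟩,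
    ⟨X, hXM, h1, rfl⟩, h2⟩
  rw [mul_assoc, ← mul_assoc (star X), h1, ← mul_assoc, hXX]

lemma exists_rotation_coefficients {a b c : ℝ} (ha : 0 ≤ a) (hab : a < b) (hac : a < c)
    (hcb : c < b) : ∃ α β α' β' : ℝ, α ^ 2 + β ^ 2 = 1 ∧ α' ^ 2 + β' ^ 2 = 1 ∧
      c * α ^ 2 + (a + b - c) * α' ^ 2 = a ∧ c * β ^ 2 + (a + b - c) * β' ^ 2 = b ∧
      c * (α * β) + (a + b - c) * (α' * β') = 0 := by
  obtain ⟨d, hd⟩ : ∃ d, d = a + b - c := ⟨_, rfl⟩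
  have hc0 : 0 < c := by linarith
  have hd0 : 0 < d := by linarith
  have hba : 0 < b - a := by linarith
  have hbc : 0 < b - c := by linarith
  have hca : 0 < c - a := by linarith
  have hb : 0 < b := by linarith
  rw [← hd]
  have hα := Real.sq_sqrt (show 0 ≤ a * (b - c) / (c * (b - a)) by positivity)
  have hβ := Real.sq_sqrt (show 0 ≤ b * (c - a) / (c * (b - a)) by positivity)
  have hα' := Real.sq_sqrt (show 0 ≤ a * (c - a) / (d * (b - a)) by positivity)
  have hβ' := Real.sq_sqrt (show 0 ≤ b * (b - c) / (d * (b - a)) by positivity)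
  refine ⟨√(a * (b - c) / (c * (b - a))), √(b * (c - a) / (c * (b - a))),
    √(a * (c - a) / (d * (b - a))), -√(b * (b - c) / (d * (b - a))), ?_, ?_, ?_, ?_, ?_⟩
  · rw [hα, hβ]
    field_simp
    ring
  · rw [neg_sq, hα', hβ']
    field_simp
    rw [hd]
    ring
  · rw [hα, hα']
    field_simp
    ring
  · rw [neg_sq, hβ, hβ']
    field_simp
    ring
  · have h1 : c * (√(a * (b - c) / (c * (b - a))) * √(b * (c - a) / (c * (b - a)))) =
        √(a * b * (b - c) * (c - a)) / (b - a) := by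
      rw [← Real.sqrt_mul (by positivity), show a * (b - c) / (c * (b - a)) *
        (b * (c - a) / (c * (b - a))) = a * b * (b - c) * (c - a) / (c * (b - a)) ^ 2 by
          field_simp, Real.sqrt_div (by positivity), Real.sqrt_sq (by positivity)]
      field_simp
    have h2 : d * (√(a * (c - a) / (d * (b - a))) * √(b * (b - c) / (d * (b - a)))) =
        √(a * b * (b - c) * (c - a)) / (b - a) := by
      rw [← Real.sqrt_mul (by positivity), show a * (c - a) / (d * (b - a)) *
        (b * (b - c) / (d * (b - a))) = a * b * (b - c) * (c - a) / (d * (b - a)) ^ 2 by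
          field_simp, Real.sqrt_div (by positivity), Real.sqrt_sq (by positivity)]
      field_simp
    rw [mul_neg, mul_neg, h1, h2, add_neg_cancel]

/-- Lemma 2.8: if `P, Q` are finite, equivalent, commuting projections in a von Neumann
algebra `M` and `0 ≤ a < b`, `a ≤ c ≤ b`, then there are projections `P' ∼ Q' ∼ P` in `M`
with `aP + bQ = cP' + (a+b-c)Q'`. -/
theorem stmt_9 (M : VonNeumannAlgebra H) (P Q : H →L[ℂ] H)
    (hPM : P ∈ M) (hQM : Q ∈ M) (hP : IsProjectionOp P) (hQ : IsProjectionOp Q)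
    (hPfin : IsFiniteProjIn M P) (hQfin : IsFiniteProjIn M Q)
    (hcomm : P * Q = Q * P) (hequiv : MvNEquivIn M P Q)
    (a b c : ℝ) (ha : 0 ≤ a) (hab : a < b) (hac : a ≤ c) (hcb : c ≤ b) :
    ∃ P' Q' : H →L[ℂ] H, P' ∈ M ∧ Q' ∈ M ∧ IsProjectionOp P' ∧ IsProjectionOp Q' ∧
      MvNEquivIn M P P' ∧ MvNEquivIn M P Q' ∧
      (a : ℂ) • P + (b : ℂ) • Q = (c : ℂ) • P' + ((a + b - c : ℝ) : ℂ) • Q' := by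
  have hPP : MvNEquivIn M P P := ⟨P, hPM, by rw [hP.1.star_eq, hP.2], by rw [hP.1.star_eq, hP.2]⟩
  rcases hac.eq_or_lt with rfl | hac'
  · exact ⟨P, Q, hPM, hQM, hP, hQ, hPP, hequiv, by rw [add_sub_cancel_left]⟩
  rcases hcb.eq_or_lt with rfl | hcb'
  · exact ⟨Q, P, hQM, hPM, hQ, hP, hequiv, hPP, by rw [add_sub_cancel_right, add_comm]⟩
  obtain ⟨W, hWM, hWp, hWq⟩ := mvNEquivIn_sub_mul M hPM hQM hP hQ hPfin hQfin hcomm hequiv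
  obtain ⟨α, β, α', β', h1, h1', h2, h3, h4⟩ := exists_rotation_coefficients ha hab hac' hcb'
  set R := P * Q with hRdef
  have hRM : R ∈ M := mul_mem hPM hQM
  have hPR : P * R = R := by rw [hRdef, ← mul_assoc, hP.2]
  have hRP : R * P = R := by rw [hcomm, mul_assoc, hP.2]
  have hRQ : R * Q = R := by rw [hRdef, mul_assoc, hQ.2]
  have hR : IsProjectionOp R := hP.mul hQ hcomm
  have hp : IsProjectionOp (P - R) := hP.sub hR hPR hRP
  have hpq : (P - R) * (Q - R) = 0 := by
    rw [sub_mul, mul_sub, mul_sub, hPR, hRQ, hR.2, ← hRdef]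
    abel
  have hRp : R * (P - R) = 0 := by rw [mul_sub, hRP, hR.2, sub_self]
  have hRq : R * (Q - R) = 0 := by rw [mul_sub, hRQ, hR.2, sub_self]
  obtain ⟨P', hP'M, hP', hPP', hP'eq⟩ := exists_rotated_projection M (sub_mem hPM hRM) hRM hWM hp hR
    hpq hRp hRq hWp hWq α β h1
  obtain ⟨Q', hQ'M, hQ', hPQ', hQ'eq⟩ := exists_rotated_projection M (sub_mem hPM hRM) hRM hWM hp hR
    hpq hRp hRq hWp hWq α' β' h1'
  rw [add_sub_cancel] at hPP' hPQ'
  refine ⟨P', Q', hP'M, hQ'M, hP', hQ', hPP', hPQ', ?_⟩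
  have h2' : (c : ℂ) * ((α ^ 2 : ℝ) : ℂ) + ((a + b - c : ℝ) : ℂ) * ((α' ^ 2 : ℝ) : ℂ) = a := by
    exact_mod_cast h2
  have h3' : (c : ℂ) * ((β ^ 2 : ℝ) : ℂ) + ((a + b - c : ℝ) : ℂ) * ((β' ^ 2 : ℝ) : ℂ) = b := by
    exact_mod_cast h3
  have h4' : (c : ℂ) * ((α * β : ℝ) : ℂ) + ((a + b - c : ℝ) : ℂ) * ((α' * β' : ℝ) : ℂ) = 0 := by
    exact_mod_cast h4
  calc (a : ℂ) • P + (b : ℂ) • Q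
      = ((c : ℂ) + ((a + b - c : ℝ) : ℂ)) • R + (a : ℂ) • (P - R) + (0 : ℂ) • (W + star W)
        + (b : ℂ) • (Q - R) := by push_cast; module
    _ = (c : ℂ) • P' + ((a + b - c : ℝ) : ℂ) • Q' := by
      generalize ((a + b - c : ℝ) : ℂ) = d at *
      rw [hP'eq, hQ'eq, ← h4', ← h3', ← h2']
      module
end

section
/- Kadison integrality: Let P ∈ B(H) be a projection with both P and I-P infinite, let (e_n) be an orthonormal basis, and set c_n := ⟨Pe_n, e_n⟩. Assume Σ{c_n : c_n ≤ 1/2} < ∞ and Σ{1-c_n : c_n > 1/2} < ∞. Then Σ{1-c_n : c_n > 1/2} − Σ{c_n : c_n ≤ 1/2} is an integer. -/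
open scoped InnerProductSpace

variable {H : Type*} [NormedAddCommGroup H] [InnerProductSpace ℂ H] [CompleteSpace H]

namespace Matrix.IsHermitian

theorem trace_mul_self_eq_sum_eigenvalues_sq {n : Type*} [Fintype n] [DecidableEq n]
    {A : Matrix n n ℂ} (hA : A.IsHermitian) :
    (A * A).trace = ∑ i, ((hA.eigenvalues i : ℂ)) ^ 2 := by
  conv_lhs => rw [hA.spectral_theorem, ← map_mul, Unitary.conjStarAlgAut_apply,
    Matrix.trace_mul_cycle, Unitary.coe_star_mul_self, one_mul, Matrix.diagonal_mul_diagonal,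
    Matrix.trace_diagonal]
  exact Finset.sum_congr rfl fun i _ ↦ by simp [sq]

open scoped ComplexOrder in
theorem eigenvalues_le_one {n : Type*} [Fintype n] [DecidableEq n]
    {A : Matrix n n ℂ} (hA : A.IsHermitian) (h : (1 - A).PosSemidef) (i : n) :
    hA.eigenvalues i ≤ 1 := by
  have h0 := h.re_dotProduct_nonneg (hA.eigenvectorBasis i)
  rw [Matrix.sub_mulVec, Matrix.one_mulVec, dotProduct_sub, map_sub, ← hA.eigenvalues_eq,
    dotProduct_comm, ← EuclideanSpace.inner_eq_star_dotProduct, inner_self_eq_norm_sq_to_K,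
    hA.eigenvectorBasis.orthonormal.1 i] at h0
  simpa using h0

end Matrix.IsHermitian

theorem exists_int_abs_sub_le_two_mul_mul_one_sub {x : ℝ} (h0 : 0 ≤ x) (h1 : x ≤ 1) :
    ∃ k : ℤ, |x - k| ≤ 2 * (x - x ^ 2) := by
  rcases le_total x (1 / 2) with h | h
  · refine ⟨0, ?_⟩
    rw [Int.cast_zero, sub_zero, abs_of_nonneg h0]
    nlinarith
  · refine ⟨1, ?_⟩
    rw [Int.cast_one, abs_of_nonpos (by linarith)]
    nlinarith

open scoped ComplexOrder in
/-- The trace of a positive semidefinite contraction `A` is within `2 * tr (A - A ^ 2)` of an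
integer. -/
theorem Matrix.PosSemidef.exists_int_abs_trace_sub_le {n : Type*} [Fintype n]
    {A : Matrix n n ℂ} [DecidableEq n] (hA : A.PosSemidef) (h : (1 - A).PosSemidef) :
    ∃ k : ℤ, |A.trace.re - k| ≤ 2 * (A.trace.re - (A * A).trace.re) := by
  choose k hk using fun i ↦ exists_int_abs_sub_le_two_mul_mul_one_sub
    (hA.eigenvalues_nonneg i) (hA.1.eigenvalues_le_one h i)
  have ht : A.trace.re = ∑ i, hA.1.eigenvalues i := by
    rw [hA.1.trace_eq_sum_eigenvalues]
    simp
  have ht2 : (A * A).trace.re = ∑ i, hA.1.eigenvalues i ^ 2 := by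
    rw [hA.1.trace_mul_self_eq_sum_eigenvalues_sq]
    norm_cast
  refine ⟨∑ i, k i, ?_⟩
  rw [ht, ht2, Int.cast_sum, ← Finset.sum_sub_distrib, ← Finset.sum_sub_distrib, Finset.mul_sum]
  exact (Finset.abs_sum_le_sum_abs _ _).trans (Finset.sum_le_sum fun i _ ↦ hk i)

namespace IsProjectionOp

variable {P : H →L[ℂ] H}

theorem inner_apply_apply (hP : IsProjectionOp P) (x y : H) : ⟪P x, P y⟫_ℂ = ⟪P x, y⟫_ℂ := by
  rw [← ContinuousLinearMap.adjoint_inner_left, hP.1.adjoint_eq]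
  exact congrArg (fun T : H →L[ℂ] H ↦ ⟪T x, y⟫_ℂ) hP.2

theorem inner_apply_left (hP : IsProjectionOp P) (x y : H) : ⟪P x, y⟫_ℂ = ⟪x, P y⟫_ℂ := by
  rw [← ContinuousLinearMap.adjoint_inner_right, hP.1.adjoint_eq]

theorem inner_self_apply_re (hP : IsProjectionOp P) (x : H) : (⟪P x, x⟫_ℂ).re = ‖P x‖ ^ 2 := by
  rw [← hP.inner_apply_apply]
  exact inner_self_eq_norm_sq (𝕜 := ℂ) (P x)

theorem one_sub_gram {ι : Type*} [DecidableEq ι] (hP : IsProjectionOp P) {v : ι → H}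
    (hv : Orthonormal ℂ v) :
    1 - Matrix.gram ℂ (fun i ↦ P (v i)) = Matrix.gram ℂ (fun i ↦ v i - P (v i)) := by
  ext i j
  rw [← Matrix.gram_eq_one_iff_orthonormal.2 hv]
  simp only [Matrix.sub_apply, Matrix.gram_apply, inner_sub_left, inner_sub_right,
    hP.inner_apply_apply, ← hP.inner_apply_left (v i) (v j)]
  ring

theorem hasSum_norm_inner_sq {ι : Type*} (hP : IsProjectionOp P) (e : HilbertBasis ι ℂ H) (x : H) :
    HasSum (fun j ↦ ‖⟪P x, P (e j)⟫_ℂ‖ ^ 2) (‖P x‖ ^ 2) := by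
  have h := Complex.hasSum_re (e.hasSum_inner_mul_inner (P x) (P x))
  convert! h using 1
  · ext j
    rw [hP.inner_apply_apply, ← inner_conj_symm (e j), Complex.mul_conj, Complex.ofReal_re,
      Complex.normSq_eq_norm_sq]
  · exact (inner_self_eq_norm_sq (𝕜 := ℂ) (P x)).symm

theorem norm_sq_le_one (hP : IsProjectionOp P) {x : H} (hx : ‖x‖ = 1) : ‖P x‖ ^ 2 ≤ 1 := by
  have h1 : ‖P x‖ ^ 2 ≤ ‖P x‖ * ‖x‖ := by
    rw [← hP.inner_self_apply_re]
    exact re_inner_le_norm (𝕜 := ℂ) (P x) x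
  rw [hx] at h1
  nlinarith [norm_nonneg (P x)]

/-- The truncation defect of the Gram matrix of `P e_0, …, P e_{N-1}` is controlled by the tail of
any summable sequence dominating `c_j - c_j ^ 2`, where `c_j = ‖P e_j‖ ^ 2`. -/
theorem sum_norm_sq_sub_sum_le (hP : IsProjectionOp P) (e : HilbertBasis ℕ ℂ H) {d : ℕ → ℝ}
    (hd : Summable d) (h : ∀ j, ‖P (e j)‖ ^ 2 - (‖P (e j)‖ ^ 2) ^ 2 ≤ d j) (N : ℕ) :
    ∑ i ∈ Finset.range N, (‖P (e i)‖ ^ 2 -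
      ∑ j ∈ Finset.range N, ‖⟪P (e i), P (e j)⟫_ℂ‖ ^ 2) ≤ ∑' j, d (j + N) := by
  have key (i : ℕ) : HasSum (fun j ↦ ‖⟪P (e i), P (e (j + N))⟫_ℂ‖ ^ 2)
      (‖P (e i)‖ ^ 2 - ∑ j ∈ Finset.range N, ‖⟪P (e i), P (e j)⟫_ℂ‖ ^ 2) :=
    (hasSum_nat_add_iff' N).2 (hP.hasSum_norm_inner_sq e (e i))
  refine hasSum_le (fun j ↦ ?_) (hasSum_sum fun i _ ↦ key i) ((summable_nat_add_iff N).2 hd).hasSum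
  refine le_trans ?_ (h (j + N))
  have h2 := sum_le_hasSum (insert (j + N) (Finset.range N)) (fun i _ ↦ by positivity)
    (hP.hasSum_norm_inner_sq e (e (j + N)))
  rw [Finset.sum_insert (by simp), inner_self_eq_norm_sq_to_K] at h2
  simp only [norm_pow, Complex.coe_algebraMap, Complex.norm_real, norm_norm] at h2
  simp only [norm_inner_symm (P (e (j + N)))] at h2
  linarith

open scoped ComplexOrder in
theorem exists_int_abs_sum_norm_sq_sub_le (hP : IsProjectionOp P) (e : HilbertBasis ℕ ℂ H)
    {d : ℕ → ℝ} (hd : Summable d) (h : ∀ j, ‖P (e j)‖ ^ 2 - (‖P (e j)‖ ^ 2) ^ 2 ≤ d j) (N : ℕ) :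
    ∃ k : ℤ, |∑ i ∈ Finset.range N, ‖P (e i)‖ ^ 2 - k| ≤ 2 * ∑' j, d (j + N) := by
  let v : Fin N → H := fun i ↦ e i
  have hv : Orthonormal ℂ v := e.orthonormal.comp _ Fin.val_injective
  let A := Matrix.gram ℂ fun i ↦ P (v i)
  obtain ⟨k, hk⟩ := (Matrix.posSemidef_gram ℂ fun i ↦ P (v i)).exists_int_abs_trace_sub_le
    (by rw [hP.one_sub_gram hv]; exact Matrix.posSemidef_gram ℂ _)
  have ht : A.trace.re = ∑ i ∈ Finset.range N, ‖P (e i)‖ ^ 2 := by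
    rw [Finset.sum_range, Matrix.trace, Complex.re_sum]
    exact Finset.sum_congr rfl fun i _ ↦ inner_self_eq_norm_sq (𝕜 := ℂ) (P (v i))
  have ht2 : (A * A).trace.re =
      ∑ i ∈ Finset.range N, ∑ j ∈ Finset.range N, ‖⟪P (e i), P (e j)⟫_ℂ‖ ^ 2 := by
    simp only [Finset.sum_range, Matrix.trace, Matrix.diag, Matrix.mul_apply, Complex.re_sum]
    refine Finset.sum_congr rfl fun i _ ↦ Finset.sum_congr rfl fun j _ ↦ ?_
    simp only [A, v, Matrix.gram_apply]
    rw [← inner_conj_symm (P (e j)), Complex.mul_conj, Complex.ofReal_re, Complex.normSq_eq_norm_sq]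
  refine ⟨k, ?_⟩
  have hle := hP.sum_norm_sq_sub_sum_le e hd h N
  change |A.trace.re - k| ≤ 2 * (A.trace.re - (A * A).trace.re) at hk
  rw [ht, ht2, ← Finset.sum_sub_distrib] at hk
  linarith

end IsProjectionOp

/-- Corollary 3.6 (Kadison's integrality condition): let `P` be a projection with both
`P` and `I - P` infinite (infinite-dimensional range and kernel), let `(e_n)` be an
orthonormal basis and `c_n = ⟨P e_n, e_n⟩`.  If `Σ{c_n : c_n ≤ 1/2} < ∞` and
`Σ{1-c_n : c_n > 1/2} < ∞`, then `Σ{1-c_n : c_n > 1/2} − Σ{c_n : c_n ≤ 1/2} ∈ ℤ`. -/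
theorem stmt_16 (e : HilbertBasis ℕ ℂ H) (P : H →L[ℂ] H) (hP : IsProjectionOp P)
    (hinf : ¬ FiniteDimensional ℂ (LinearMap.range (P : H →ₗ[ℂ] H)))
    (hcoinf : ¬ FiniteDimensional ℂ (LinearMap.ker (P : H →ₗ[ℂ] H)))
    (c : ℕ → ℝ) (hc : ∀ n, c n = (⟪P (e n), e n⟫_ℂ).re)
    (hsum1 : Summable (fun n => if c n ≤ 1/2 then c n else 0))
    (hsum2 : Summable (fun n => if 1/2 < c n then 1 - c n else 0)) :
    ∃ k : ℤ, (∑' n, if 1/2 < c n then 1 - c n else 0)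
      - (∑' n, if c n ≤ 1/2 then c n else 0) = (k : ℝ) := by
  have hcn (n : ℕ) : c n = ‖P (e n)‖ ^ 2 := (hc n).trans (hP.inner_self_apply_re _)
  have hc0 (n : ℕ) : 0 ≤ c n := hcn n ▸ sq_nonneg _
  have hc1 (n : ℕ) : c n ≤ 1 := hcn n ▸ hP.norm_sq_le_one (e.orthonormal.1 n)
  set f : ℕ → ℝ := fun n ↦ if c n ≤ 1/2 then c n else 0
  set g : ℕ → ℝ := fun n ↦ if 1/2 < c n then 1 - c n else 0
  have hd (j : ℕ) : ‖P (e j)‖ ^ 2 - (‖P (e j)‖ ^ 2) ^ 2 ≤ f j + g j := by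
    rw [← hcn]
    simp only [f, g]
    split_ifs <;> nlinarith [hc0 j, hc1 j]
  have hgf (n : ℕ) : g n - f n = ((if 1/2 < c n then 1 else 0 : ℤ) : ℝ) - ‖P (e n)‖ ^ 2 := by
    rw [← hcn]
    simp only [f, g]
    split_ifs <;> first | (exfalso; linarith) | simp
  suffices h : ∑' n, g n - ∑' n, f n ∈ closure (Set.range ((↑) : ℤ → ℝ)) by
    rw [Int.isClosedEmbedding_coe_real.isClosed_range.closure_eq] at h
    exact h.imp fun k hk ↦ hk.symm
  rw [Metric.mem_closure_iff]
  intro ε hε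
  have hlim := (hsum2.hasSum.sub hsum1.hasSum).tendsto_sum_nat
  have htail := tendsto_sum_nat_add fun n ↦ f n + g n
  obtain ⟨N, hN, hN'⟩ := ((Metric.tendsto_nhds.1 hlim (ε / 2) (by positivity)).and
    (Metric.tendsto_nhds.1 htail (ε / 4) (by positivity))).exists
  obtain ⟨k, hk⟩ := hP.exists_int_abs_sum_norm_sq_sub_le e (hsum1.add hsum2) hd N
  refine ⟨_, ⟨∑ n ∈ Finset.range N, (if 1/2 < c n then 1 else 0 : ℤ) - k, rfl⟩, ?_⟩
  rw [Real.dist_eq, Finset.sum_congr rfl fun n _ ↦ hgf n, Finset.sum_sub_distrib] at hN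
  rw [Real.dist_eq, sub_zero] at hN'
  rw [Real.dist_eq, Int.cast_sub, Int.cast_sum]
  have h4 := (le_abs_self _).trans_lt hN'
  rw [abs_lt] at hN ⊢
  rw [abs_le] at hk
  constructor <;> linarith [hk.1, hk.2, hN.1, hN.2]
end
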